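/- Let κ_v, a_v, σ_v, κ_f, a_f, σ_f > 0, θ_v, θ_f ≥ 0 and ρ_{vf} ∈ (−1,1). For s ∈ ℝ, u = (u₁,u₂) ∈ ℝ², x = (x₁,x₂) ∈ ℝ², define g(s,u,x) ∈ ℝ² by g₁(s,u,x) = θ_v·s·1_{(0,∞)}(s) + σ_v·u₁·√x₁·1_{(0,∞)}(x₁) and g₂(s,u,x) = θ_f·s·1_{(0,∞)}(s) + σ_f·ρ_{vf}·u₁·√x₂·1_{(0,∞)}(x₂) + σ_f·√(1−ρ_{vf}²)·u₂·√x₂·1_{(0,∞)}(x₂). Then there exists a constant C > 0 such that for all x, y ∈ ℝ² one has ∫_{ℝ³} |g(s,u,x) − g(s,u,y)|² dν₂(s,u) ≤ C|x − y|, where |·| denotes the Euclidean norm. -/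

import Mathlib

open MeasureTheory Real Set

/-- The Gamma Lévy density `g_γ(s) = (α/s)·e^{−βs}` for `s > 0`, `0` otherwise. -/
noncomputable def gGamma (α β : ℝ) (s : ℝ) : ℝ :=
  if 0 < s then (α / s) * Real.exp (-β * s) else 0

/-- The two-dimensional heat kernel `p₂(s,u) = (2πs)^{−1}·e^{−|u|²/(2s)}` for `s > 0`. -/
noncomputable def p2 (s : ℝ) (u : ℝ × ℝ) : ℝ :=
  if 0 < s then (2 * Real.pi * s)⁻¹ * Real.exp (-(u.1 ^ 2 + u.2 ^ 2) / (2 * s)) else 0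

/-- The measure `ν₂` on `ℝ³ = ℝ × ℝ²` with density `(s,u) ↦ g_γ(s)·p₂(s,u)` w.r.t. Lebesgue
measure. -/
noncomputable def nu2 (α β : ℝ) : Measure (ℝ × ℝ × ℝ) :=
  (volume : Measure (ℝ × ℝ × ℝ)).withDensity fun q =>
    ENNReal.ofReal (gGamma α β q.1 * p2 q.1 q.2)

/-- The indicator function `1_{(0,∞)}`. -/
noncomputable def indPos (x : ℝ) : ℝ := if 0 < x then 1 else 0

/-- First (variance) component of the jump coefficient of the coupled
variance/foreign-rate system:
`g₁(s,u,x) = θ_v·s·1_{(0,∞)}(s) + σ_v·u₁·√x₁·1_{(0,∞)}(x₁)`. -/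
noncomputable def gVc (θv σv : ℝ) (s : ℝ) (u x : ℝ × ℝ) : ℝ :=
  θv * s * indPos s + σv * u.1 * Real.sqrt x.1 * indPos x.1

/-- Second (foreign-rate) component of the jump coefficient of the coupled
variance/foreign-rate system:
`g₂(s,u,x) = θ_f·s·1_{(0,∞)}(s) + σ_f·ρ_{vf}·u₁·√x₂·1_{(0,∞)}(x₂)
  + σ_f·√(1−ρ_{vf}²)·u₂·√x₂·1_{(0,∞)}(x₂)`. -/
noncomputable def gFc (θf σf ρvf : ℝ) (s : ℝ) (u x : ℝ × ℝ) : ℝ :=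
  θf * s * indPos s + σf * ρvf * u.1 * Real.sqrt x.2 * indPos x.2 +
    σf * Real.sqrt (1 - ρvf ^ 2) * u.2 * Real.sqrt x.2 * indPos x.2

theorem sqrt_mul_indPos (x : ℝ) : Real.sqrt x * indPos x = Real.sqrt x := by
  unfold indPos
  split_ifs with h
  · exact mul_one _
  · rw [Real.sqrt_eq_zero_of_nonpos (not_lt.mp h), zero_mul]

theorem sqrt_sub_sqrt_sq_le (a b : ℝ) : (Real.sqrt a - Real.sqrt b) ^ 2 ≤ |a - b| := by
  wlog hab : a ≤ b generalizing a b
  · rw [abs_sub_comm, sub_sq_comm]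
    exact this b a (le_of_not_ge hab)
  rw [abs_sub_comm, abs_of_nonneg (sub_nonneg.mpr hab)]
  have hp := Real.sqrt_nonneg a
  have hpq := Real.sqrt_le_sqrt hab
  have hq2 : Real.sqrt b ^ 2 - Real.sqrt a ^ 2 ≤ b - a := by
    rcases le_total 0 a with ha | ha
    · rw [Real.sq_sqrt ha, Real.sq_sqrt (ha.trans hab)]
    · rw [Real.sqrt_eq_zero_of_nonpos ha]
      rcases le_total 0 b with hb | hb
      · rw [Real.sq_sqrt hb]
        linarith
      · rw [Real.sqrt_eq_zero_of_nonpos hb]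
        linarith
  nlinarith [mul_nonneg hp (sub_nonneg.mpr hpq)]

theorem measurable_gGamma (α β : ℝ) : Measurable (gGamma α β) :=
  Measurable.ite measurableSet_Ioi (by fun_prop) measurable_const

theorem measurable_p2 : Measurable fun q : ℝ × ℝ × ℝ => p2 q.1 q.2 :=
  Measurable.ite (measurableSet_lt measurable_const measurable_fst) (by fun_prop) measurable_const

/-- The Gaussian mass of the plane, `∫ e^{−b|u|²} du = π / b`. -/
theorem lintegral_exp_neg_mul_sq_add_sq {b : ℝ} (hb : 0 < b) :
    ∫⁻ u : ℝ × ℝ, ENNReal.ofReal (Real.exp (-b * u.1 ^ 2) * Real.exp (-b * u.2 ^ 2)) =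
      ENNReal.ofReal (Real.pi / b) := by
  have hint := integrable_exp_neg_mul_sq hb
  rw [Measure.volume_eq_prod, ← ofReal_integral_eq_lintegral_ofReal (hint.mul_prod hint)
    (Filter.Eventually.of_forall fun u => by positivity),
    integral_prod_mul (fun x => Real.exp (-b * x ^ 2)) (fun x => Real.exp (-b * x ^ 2)),
    integral_gaussian, Real.mul_self_sqrt (by positivity)]

theorem gGamma_mul_p2_mul_sq_le {α β s : ℝ} (hα : 0 < α) (hs : 0 < s) (u : ℝ × ℝ) :
    gGamma α β s * p2 s u * (u.1 ^ 2 + u.2 ^ 2) ≤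
      2 * α / (Real.pi * s) * Real.exp (-β * s) *
        (Real.exp (-(1 / (4 * s)) * u.1 ^ 2) * Real.exp (-(1 / (4 * s)) * u.2 ^ 2)) := by
  rw [gGamma, p2, if_pos hs, if_pos hs, ← Real.exp_add]
  set t := (u.1 ^ 2 + u.2 ^ 2) / (4 * s) with ht
  have hu : u.1 ^ 2 + u.2 ^ 2 = 4 * s * t := by rw [ht]; field_simp
  have h1 : -(u.1 ^ 2 + u.2 ^ 2) / (2 * s) = -t + -t := by rw [ht]; field_simp; ring
  have h2 : -(1 / (4 * s)) * u.1 ^ 2 + -(1 / (4 * s)) * u.2 ^ 2 = -t := by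
    rw [ht]; field_simp; ring
  rw [h1, h2, hu, Real.exp_add]
  have hle : t * Real.exp (-t) ≤ 1 := by
    rw [Real.exp_neg, ← div_eq_mul_inv, div_le_one (Real.exp_pos t)]
    linarith [Real.add_one_le_exp t]
  calc α / s * Real.exp (-β * s) * ((2 * Real.pi * s)⁻¹ * (Real.exp (-t) * Real.exp (-t))) *
        (4 * s * t)
      = 2 * α / (Real.pi * s) * Real.exp (-β * s) * Real.exp (-t) * (t * Real.exp (-t)) := by
        field_simp
        ring
    _ ≤ 2 * α / (Real.pi * s) * Real.exp (-β * s) * Real.exp (-t) * 1 := by gcongr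
    _ = _ := mul_one _

/-- The measure `ν₂` has finite second moment in the space variable. -/
theorem lintegral_sq_nu2_lt_top {α β : ℝ} (hα : 0 < α) (hβ : 0 < β) :
    ∫⁻ q : ℝ × ℝ × ℝ, ENNReal.ofReal (q.2.1 ^ 2 + q.2.2 ^ 2) ∂nu2 α β < ⊤ := by
  have hm : Measurable fun q : ℝ × ℝ × ℝ => ENNReal.ofReal (gGamma α β q.1 * p2 q.1 q.2) :=
    (((measurable_gGamma α β).comp measurable_fst).mul measurable_p2).ennreal_ofReal
  have hsq : Measurable fun q : ℝ × ℝ × ℝ => ENNReal.ofReal (q.2.1 ^ 2 + q.2.2 ^ 2) := by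
    fun_prop
  rw [nu2, lintegral_withDensity_eq_lintegral_mul _ hm hsq, Measure.volume_eq_prod,
    lintegral_prod _ (hm.mul hsq).aemeasurable]
  have hinner (s : ℝ) :
      ∫⁻ u : ℝ × ℝ, ((fun q : ℝ × ℝ × ℝ => ENNReal.ofReal (gGamma α β q.1 * p2 q.1 q.2)) *
        fun q : ℝ × ℝ × ℝ => ENNReal.ofReal (q.2.1 ^ 2 + q.2.2 ^ 2)) (s, u) ≤
      (Ioi 0).indicator (fun s => ENNReal.ofReal (8 * α * Real.exp (-β * s))) s := by
    by_cases hs : 0 < s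
    · rw [indicator_of_mem (mem_Ioi.mpr hs)]
      have hc : 0 ≤ 2 * α / (Real.pi * s) * Real.exp (-β * s) := by positivity
      calc _ ≤ ∫⁻ u : ℝ × ℝ, ENNReal.ofReal (2 * α / (Real.pi * s) * Real.exp (-β * s)) *
            ENNReal.ofReal (Real.exp (-(1 / (4 * s)) * u.1 ^ 2) *
              Real.exp (-(1 / (4 * s)) * u.2 ^ 2)) := by
            refine lintegral_mono fun u => ?_
            rw [Pi.mul_apply, ← ENNReal.ofReal_mul' (by positivity), ← ENNReal.ofReal_mul hc]
            exact ENNReal.ofReal_le_ofReal (gGamma_mul_p2_mul_sq_le hα hs u)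
        _ = ENNReal.ofReal (8 * α * Real.exp (-β * s)) := by
            rw [lintegral_const_mul _ (by fun_prop),
              lintegral_exp_neg_mul_sq_add_sq (by positivity), ← ENNReal.ofReal_mul hc]
            congr 1
            field_simp
            ring
        _ ≤ _ := le_rfl
    · simp [gGamma, hs]
  refine (lintegral_mono hinner).trans_lt ?_
  rw [lintegral_indicator measurableSet_Ioi]
  exact ((exp_neg_integrableOn_Ioi 0 hβ).const_mul (8 * α)).lintegral_lt_top

theorem sq_gVc_sub_add_sq_gFc_sub_le {ρ : ℝ} (hρ : ρ ∈ Icc (-1 : ℝ) 1) (θv σv θf σf s : ℝ)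
    (u x y : ℝ × ℝ) :
    (gVc θv σv s u x - gVc θv σv s u y) ^ 2 + (gFc θf σf ρ s u x - gFc θf σf ρ s u y) ^ 2 ≤
      (σv ^ 2 + σf ^ 2) * Real.sqrt ((x.1 - y.1) ^ 2 + (x.2 - y.2) ^ 2) *
        (u.1 ^ 2 + u.2 ^ 2) := by
  set D := Real.sqrt ((x.1 - y.1) ^ 2 + (x.2 - y.2) ^ 2)
  set r := Real.sqrt (1 - ρ ^ 2) with hr
  have hr2 : r ^ 2 = 1 - ρ ^ 2 := Real.sq_sqrt (by nlinarith [hρ.1, hρ.2])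
  have hV : gVc θv σv s u x - gVc θv σv s u y =
      σv * u.1 * (Real.sqrt x.1 - Real.sqrt y.1) := by
    simp only [gVc, mul_assoc, sqrt_mul_indPos]
    ring
  have hF : gFc θf σf ρ s u x - gFc θf σf ρ s u y =
      σf * (ρ * u.1 + r * u.2) * (Real.sqrt x.2 - Real.sqrt y.2) := by
    simp only [gFc, mul_assoc, sqrt_mul_indPos, ← hr]
    ring
  have h1 : (Real.sqrt x.1 - Real.sqrt y.1) ^ 2 ≤ D :=
    (sqrt_sub_sqrt_sq_le _ _).trans (Real.abs_le_sqrt (by nlinarith [sq_nonneg (x.2 - y.2)]))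
  have h2 : (Real.sqrt x.2 - Real.sqrt y.2) ^ 2 ≤ D :=
    (sqrt_sub_sqrt_sq_le _ _).trans (Real.abs_le_sqrt (by nlinarith [sq_nonneg (x.1 - y.1)]))
  have hu1 : u.1 ^ 2 ≤ u.1 ^ 2 + u.2 ^ 2 := by nlinarith [sq_nonneg u.2]
  have hu2 : (ρ * u.1 + r * u.2) ^ 2 ≤ u.1 ^ 2 + u.2 ^ 2 := by
    have : u.1 ^ 2 + u.2 ^ 2 = (ρ * u.1 + r * u.2) ^ 2 + (r * u.1 - ρ * u.2) ^ 2 := by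
      linear_combination -(u.1 ^ 2 + u.2 ^ 2) * hr2
    rw [this]
    exact le_add_of_nonneg_right (sq_nonneg _)
  rw [hV, hF]
  simp only [mul_pow]
  calc _ ≤ σv ^ 2 * (u.1 ^ 2 + u.2 ^ 2) * D + σf ^ 2 * (u.1 ^ 2 + u.2 ^ 2) * D := by gcongr
    _ = _ := by ring

/-- The square-root Hölder-type estimate for the jump coefficient `g = (g₁, g₂)` of the coupled
variance/foreign-rate system: there is `C > 0` such that
`∫_{ℝ³} |g(s,u,x) − g(s,u,y)|² dν₂(s,u) ≤ C|x − y|` for all `x, y ∈ ℝ²`, where `|·|` denotes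
the Euclidean norm. -/
theorem coupled_system_sq_difference_integral_holder (α β κv av σv θv κf af σf θf ρvf : ℝ)
    (hα : 0 < α) (hβ : 0 < β) (hκv : 0 < κv) (hav : 0 < av) (hσv : 0 < σv)
    (hκf : 0 < κf) (haf : 0 < af) (hσf : 0 < σf) (hθv : 0 ≤ θv) (hθf : 0 ≤ θf)
    (hρvf : ρvf ∈ Set.Ioo (-1 : ℝ) 1) :
    ∃ C > 0, ∀ x y : ℝ × ℝ,
      (∫⁻ q : ℝ × ℝ × ℝ,
          ENNReal.ofReal ((gVc θv σv q.1 q.2 x - gVc θv σv q.1 q.2 y) ^ 2 +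
            (gFc θf σf ρvf q.1 q.2 x - gFc θf σf ρvf q.1 q.2 y) ^ 2)
            ∂nu2 α β) ≤
        ENNReal.ofReal (C * Real.sqrt ((x.1 - y.1) ^ 2 + (x.2 - y.2) ^ 2)) := by
  set M := ∫⁻ q : ℝ × ℝ × ℝ, ENNReal.ofReal (q.2.1 ^ 2 + q.2.2 ^ 2) ∂nu2 α β with hM
  have hMtop : M < ⊤ := lintegral_sq_nu2_lt_top hα hβ
  refine ⟨(σv ^ 2 + σf ^ 2) * (M.toReal + 1), by positivity, fun x y => ?_⟩
  set D := Real.sqrt ((x.1 - y.1) ^ 2 + (x.2 - y.2) ^ 2)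
  have hD : 0 ≤ D := Real.sqrt_nonneg _
  have hK : 0 ≤ (σv ^ 2 + σf ^ 2) * D := by positivity
  calc _ ≤ ∫⁻ q : ℝ × ℝ × ℝ, ENNReal.ofReal ((σv ^ 2 + σf ^ 2) * D) *
        ENNReal.ofReal (q.2.1 ^ 2 + q.2.2 ^ 2) ∂nu2 α β := by
        refine lintegral_mono fun q => ?_
        rw [← ENNReal.ofReal_mul hK]
        exact ENNReal.ofReal_le_ofReal
          (sq_gVc_sub_add_sq_gFc_sub_le (Ioo_subset_Icc_self hρvf) _ _ _ _ _ _ _ _)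
    _ = ENNReal.ofReal ((σv ^ 2 + σf ^ 2) * D * M.toReal) := by
        rw [lintegral_const_mul _ (by fun_prop), ← hM, ENNReal.ofReal_mul hK,
          ENNReal.ofReal_toReal hMtop.ne]
    _ ≤ _ := ENNReal.ofReal_le_ofReal (by nlinarith)
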